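/- Let (X,d) be a metric space with labels in {−1,1}. There exists a reconstruction function R mapping each pair of finite sequences ((a_1,β_1),…,(a_m,β_m)), ((c_1,γ_1),…,(c_m,γ_m)) of labeled points of X (any m ≥ 1) to a classifier R(·,·) : X → {−1,1}, such that for every finite labeled set S ⊂ X, every subset S̃ ⊆ S of cardinality m, and every weight function w : S̃ → (0,∞) for which the pair (S̃,w) is WNN-consistent with S, there exist a sequence S̃′ enumerating the labeled points of S̃ in some order and a sequence W′ of m labeled points of S such that R(S̃′, W′)(x) = l(x) for every x ∈ S, where l(x) is the label of x in S. -/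

import Mathlib

open Classical

/-- `(T, w)` is WNN-consistent with the finite labeled set `S` (labels given by `l`). -/
def WNNConsistent {X : Type*} [MetricSpace X] (l : X → Bool) (S T : Finset X)
    (w : X → ℝ) : Prop :=
  ∀ p ∈ S, ∃ q ∈ T, l q = l p ∧ ∀ q' ∈ T, l q' ≠ l p →
    dist p q / w q < dist p q' / w q'

open scoped NNReal Topology

/-- The strength `max_{q ∈ A, k q = c} w q / d(p, q)` with which the points of `A` labeled `c`
attract `p`. -/
noncomputable def attraction {X : Type*} [MetricSpace X] (k : X → Bool) (A : Finset X)
    (w : X → ℝ≥0) (p : X) (c : Bool) : ℝ≥0 :=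
  (A.filter fun q => k q = c).sup fun q => w q / nndist p q

/-- Every point of `S` outside `T` is attracted more strongly by its own label. -/
def CorrectOutside {X : Type*} [MetricSpace X] (k l : X → Bool) (S T : Finset X)
    (w : X → ℝ≥0) : Prop :=
  ∀ p ∈ S, p ∉ T → attraction k T w p (!l p) < attraction k T w p (l p)

/-- The weight of a new point `q` that makes it almost balance the attraction of `A` on `p`
towards the label opposite to `c`; the choice `p = q` stands for a negligible weight. -/
noncomputable def nextWeight {X : Type*} [MetricSpace X] (k : X → Bool) (A : Finset X)
    (w : X → ℝ≥0) (q p : X) (c : Bool) (ε : ℝ≥0) : ℝ≥0 :=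
  if p = q then ε else (1 + ε) * nndist p q * attraction k A w p (!c)

/-- An ultrafilter of positive numbers tending to zero. -/
noncomputable def infinitesimal : Ultrafilter ℝ≥0 := Ultrafilter.of (𝓝[>] 0)

/-- The generic weight function obtained by assigning weights one point after another, with
successively smaller infinitesimal slacks. -/
noncomputable def genericWeight {X : Type*} [MetricSpace X] (k : X → Bool) :
    List (X × X × Bool) → Finset X → (X → ℝ≥0) → Ultrafilter (X → ℝ≥0)
  | [], _, w => pure w
  | (q, p, c) :: L, A, w => infinitesimal.bind fun ε =>
      genericWeight k L (insert q A) (Function.update w q (nextWeight k A w q p c ε))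

section Weights

variable {X : Type*} [MetricSpace X] {k l : X → Bool} {S T A : Finset X} {w w' : X → ℝ≥0}

lemma attraction_congr (h : ∀ q ∈ A, w q = w' q) (p : X) (c : Bool) :
    attraction k A w p c = attraction k A w' p c :=
  Finset.sup_congr rfl fun q hq => by rw [h q (Finset.mem_filter.1 hq).1]

lemma CorrectOutside.congr (hw : CorrectOutside k l S T w) (h : ∀ q ∈ T, w q = w' q) :
    CorrectOutside k l S T w' := by
  intro p hp hpT
  rw [← attraction_congr h, ← attraction_congr h]
  exact hw p hp hpT

lemma nextWeight_congr (h : ∀ q ∈ A, w q = w' q) (q p : X) (c : Bool) (ε : ℝ≥0) :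
    nextWeight k A w q p c ε = nextWeight k A w' q p c ε := by
  simp only [nextWeight, attraction_congr h]

lemma attraction_smul (s : ℝ≥0) (p : X) (c : Bool) :
    attraction k A (fun x => s * w x) p c = s * attraction k A w p c := by
  simp only [attraction, NNReal.mul_finset_sup, mul_div_assoc]

lemma attraction_eq_max (hA : A ⊆ T) (w : X → ℝ≥0) (p : X) (c : Bool) :
    attraction k T w p c = max (attraction k A w p c) (attraction k (T \ A) w p c) := by
  conv_lhs => rw [← Finset.union_sdiff_of_subset hA]
  rw [attraction, Finset.filter_union, Finset.sup_union]
  rfl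

lemma attraction_rescale (hA : A ⊆ T) (s : ℝ≥0) (p : X) (c : Bool) :
    attraction k T (fun x => if x ∈ A then w x else s * w x) p c =
      max (attraction k A w p c) (s * attraction k (T \ A) w p c) := by
  rw [attraction_eq_max hA, ← attraction_smul]
  congr 1
  · exact attraction_congr (fun q hq => by simp [hq]) p c
  · exact attraction_congr (fun q hq => by simp [(Finset.mem_sdiff.1 hq).2]) p c

lemma max_lt_max_mul {a b c e s : ℝ≥0} (hs : 0 < s) (hs1 : s ≤ 1) (h : max b e < max a c)
    (hb : 0 < b → a ≤ b → b < s * c) : max b (s * e) < max a (s * c) := by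
  have hse : s * e ≤ e := mul_le_of_le_one_left zero_le hs1
  obtain ⟨h1, h2⟩ := max_lt_iff.1 h
  rcases lt_or_ge b a with hba | hab
  · refine max_lt (lt_max_of_lt_left hba) ?_
    rcases lt_max_iff.1 h2 with h3 | h3
    · exact lt_max_of_lt_left (hse.trans_lt h3)
    · exact lt_max_of_lt_right (mul_lt_mul_of_pos_left h3 hs)
  · have hbc : b < c := (lt_max_iff.1 h1).resolve_left hab.not_gt
    have hec : e < c := by
      rcases lt_max_iff.1 h2 with h3 | h3
      · exact h3.trans_le (hab.trans hbc.le)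
      · exact h3
    refine max_lt (lt_max_of_lt_right ?_) (lt_max_of_lt_right (mul_lt_mul_of_pos_left hec hs))
    rcases eq_or_ne b 0 with rfl | h0
    · exact mul_pos hs hbc
    · exact hb (pos_iff_ne_zero.2 h0) hab

/-- Scaling down the weights outside `A` preserves correctness as long as it does so at the
points where `A` alone does not attract towards the correct label. -/
lemma CorrectOutside.rescale (hw : CorrectOutside k l S T w) (hA : A ⊆ T) {s : ℝ≥0}
    (hs : 0 < s) (hs1 : s ≤ 1)
    (h : ∀ p ∈ S, p ∉ T → 0 < attraction k A w p (!l p) →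
      attraction k A w p (l p) ≤ attraction k A w p (!l p) →
      attraction k A w p (!l p) < s * attraction k (T \ A) w p (l p)) :
    CorrectOutside k l S T (fun x => if x ∈ A then w x else s * w x) := by
  intro p hp hpT
  have h0 := hw p hp hpT
  rw [attraction_eq_max hA, attraction_eq_max hA] at h0
  rw [attraction_rescale hA, attraction_rescale hA]
  exact max_lt_max_mul hs hs1 h0 (h p hp hpT)

/-- One more weight can be put in the normal form given by `nextWeight`. -/
lemma CorrectOutside.exists_nextWeight (hw : CorrectOutside k l S T w) (hA : A ⊆ T) (hT : T ⊆ S)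
    (hne : (T \ A).Nonempty) (hpos : ∀ q ∈ T, 0 < w q) :
    ∀ᶠ ε in 𝓝[>] (0 : ℝ≥0), ∃ q ∈ T \ A, ∃ p ∈ S, ∃ w' : X → ℝ≥0,
      (∀ x ∈ T, 0 < w' x) ∧ CorrectOutside k l S T w' ∧ (∀ x ∈ A, w' x = w x) ∧
      w' q = nextWeight k A w q p (l p) ε := by
  set P := S.filter fun p => p ∉ T ∧ 0 < attraction k A w p (!l p) ∧
      attraction k A w p (l p) ≤ attraction k A w p (!l p) with hP
  have posScale : ∀ s : ℝ≥0, 0 < s → ∀ x ∈ T, 0 < (if x ∈ A then w x else s * w x) := by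
    intro s hs x hx
    split_ifs
    · exact hpos x hx
    · exact mul_pos hs (hpos x hx)
  rcases P.eq_empty_or_nonempty with hPe | hPne
  · obtain ⟨q, hq⟩ := hne
    obtain ⟨hqT, hqA⟩ := Finset.mem_sdiff.1 hq
    have hq0 := hpos q hqT
    filter_upwards [Ioo_mem_nhdsGT hq0] with ε hε
    have hs : 0 < ε / w q := div_pos hε.1 hq0
    refine ⟨q, hq, q, hT hqT, fun x => if x ∈ A then w x else ε / w q * w x, posScale _ hs,
      hw.rescale hA hs (div_le_one_of_le₀ hε.2.le zero_le) ?_, fun x hx => if_pos hx, ?_⟩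
    · intro p hp hpT h1 h2
      have : p ∈ P := Finset.mem_filter.2 ⟨hp, hpT, h1, h2⟩
      simp [hPe] at this
    · simp [hqA, nextWeight, hq0.ne']
  · have key : ∀ p ∈ P, attraction k A w p (!l p) < attraction k (T \ A) w p (l p) := by
      intro p hp
      obtain ⟨hpS, hpT, h0, h1⟩ := Finset.mem_filter.1 hp
      have h := hw p hpS hpT
      rw [attraction_eq_max hA, attraction_eq_max hA] at h
      exact (lt_max_iff.1 (max_lt_iff.1 h).1).resolve_left h1.not_gt
    obtain ⟨p, hp, hmax⟩ := P.exists_max_image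
      (fun p => attraction k A w p (!l p) / attraction k (T \ A) w p (l p)) hPne
    obtain ⟨hpS, hpT, hb0, hab⟩ := Finset.mem_filter.1 hp
    have hbc := key p hp
    have hc0 := hb0.trans hbc
    have hne' : ((T \ A).filter fun q => k q = l p).Nonempty := by
      rw [Finset.nonempty_iff_ne_empty]
      intro h
      rw [attraction, h] at hc0
      simp at hc0
    obtain ⟨q, hq, hqc⟩ := Finset.exists_mem_eq_sup _ hne' fun q => w q / nndist p q
    change attraction k (T \ A) w p (l p) = _ at hqc
    have hqTA := (Finset.mem_filter.1 hq).1
    obtain ⟨hqT, hqA⟩ := Finset.mem_sdiff.1 hqTA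
    have hpq : p ≠ q := fun h => hpT (h ▸ hqT)
    have hd : nndist p q ≠ 0 := by simpa using hpq
    have hq0 := hpos q hqT
    set b := attraction k A w p (!l p) with hb
    set c := attraction k (T \ A) w p (l p) with hc
    have hcont : Filter.Tendsto (fun ε : ℝ≥0 => (1 + ε) * (b / c)) (𝓝[>] 0) (𝓝 (b / c)) := by
      have : Continuous fun ε : ℝ≥0 => (1 + ε) * (b / c) := by fun_prop
      simpa using (this.tendsto 0).mono_left nhdsWithin_le_nhds
    filter_upwards [hcont.eventually (Iio_mem_nhds ((div_lt_one hc0).2 hbc)),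
      self_mem_nhdsWithin] with ε hε1 hε0
    have hε0 : 0 < ε := hε0
    have hbc0 : 0 < b / c := div_pos hb0 hc0
    have hs : 0 < (1 + ε) * (b / c) := mul_pos (by positivity) hbc0
    refine ⟨q, hqTA, p, hpS, fun x => if x ∈ A then w x else (1 + ε) * (b / c) * w x,
      posScale _ hs, hw.rescale hA hs (le_of_lt hε1) ?_, fun x hx => if_pos hx, ?_⟩
    · intro p' hp' hpT' h1 h2
      have hm : p' ∈ P := Finset.mem_filter.2 ⟨hp', hpT', h1, h2⟩
      have h3 := hmax p' hm
      rw [← div_lt_iff₀ (h1.trans (key p' hm))]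
      refine h3.trans_lt ?_
      exact lt_mul_of_one_lt_left hbc0 (lt_add_of_pos_right _ hε0)
    · simp only [nextWeight, hqA, hpq, if_false]
      rw [← hb, hqc]
      field_simp

lemma finite_lists_of_length {α : Type*} {s : Set α} (hs : s.Finite) (n : ℕ) :
    {L : List α | L.length = n ∧ ∀ x ∈ L, x ∈ s}.Finite := by
  have := hs.to_subtype
  refine ((List.finite_length_eq s n).image (List.map Subtype.val)).subset ?_
  rintro L ⟨hn, hL⟩
  exact ⟨L.attach.map fun x => ⟨x.1, hL x.1 x.2⟩, by simpa using hn, by simp⟩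

/-- Some code, consisting of an enumeration of `T \ A` and auxiliary points of `S`, describes a
generic weight function that classifies `S` correctly. -/
lemma CorrectOutside.exists_code (hT : T ⊆ S) (n : ℕ) : ∀ (A : Finset X) (w w₀ : X → ℝ≥0),
    A ⊆ T → (T \ A).card = n → (∀ q ∈ T, 0 < w q) → CorrectOutside k l S T w →
    (∀ q ∈ A, w q = w₀ q) → ∃ C : List (X × X), (C.length = n ∧ ∀ x ∈ C, x ∈ T ×ˢ S) ∧
      (C.map Prod.fst).Nodup ∧ (C.map Prod.fst).toFinset = T \ A ∧
      ∀ᶠ v in genericWeight k (C.map fun x => (x.1, x.2, l x.2)) A w₀,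
        CorrectOutside k l S T v := by
  induction n with
  | zero =>
    intro A w w₀ hA hn hpos hw h
    have h0 := Finset.card_eq_zero.1 hn
    have hTA : T ⊆ A := Finset.sdiff_eq_empty_iff_subset.1 h0
    refine ⟨[], by simp, by simp, by simp [h0], ?_⟩
    exact hw.congr fun q hq => h q (hTA hq)
  | succ n ih =>
    intro A w w₀ hA hn hpos hw h
    have hne : (T \ A).Nonempty := Finset.card_pos.1 (by omega)
    have hev : ∀ᶠ ε in infinitesimal, ∃ C ∈ {C : List (X × X) | C.length = n + 1 ∧
        ∀ x ∈ C, x ∈ (↑(T ×ˢ S) : Set (X × X))}, (C.map Prod.fst).Nodup ∧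
        (C.map Prod.fst).toFinset = T \ A ∧
        ∃ q p C', C = (q, p) :: C' ∧
          ∀ᶠ v in genericWeight k (C'.map fun x => (x.1, x.2, l x.2)) (insert q A)
            (Function.update w₀ q (nextWeight k A w₀ q p (l p) ε)),
            CorrectOutside k l S T v := by
      refine Ultrafilter.of_le _ ?_
      filter_upwards [hw.exists_nextWeight hA hT hne hpos] with ε hε
      obtain ⟨q, hq, p, hp, w', hpos', hw', hA', hq'⟩ := hε
      obtain ⟨hqT, hqA⟩ := Finset.mem_sdiff.1 hq
      have hsd : T \ insert q A = (T \ A).erase q := by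
        ext x; simp only [Finset.mem_sdiff, Finset.mem_insert, Finset.mem_erase]; tauto
      obtain ⟨C, ⟨hlen, hmem⟩, hnd, hset, hgen⟩ := ih (insert q A) w'
        (Function.update w₀ q (nextWeight k A w₀ q p (l p) ε))
        (Finset.insert_subset hqT hA) (by rw [hsd, Finset.card_erase_of_mem hq]; omega)
        hpos' hw' (by
          intro x hx
          rcases eq_or_ne x q with rfl | hxq
          · rw [Function.update_self, hq', nextWeight_congr h]
          · have hxA := Finset.mem_of_mem_insert_of_ne hx hxq
            rw [Function.update_of_ne hxq, hA' x hxA, h x hxA])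
      refine ⟨(q, p) :: C, ⟨by simp [hlen], ?_⟩, ?_, ?_, q, p, C, rfl, hgen⟩
      · intro x hx
        rcases List.mem_cons.1 hx with rfl | hx
        · exact Finset.mem_coe.2 (Finset.mk_mem_product hqT hp)
        · exact Finset.mem_coe.2 (hmem x hx)
      · rw [List.map_cons, List.nodup_cons]
        refine ⟨fun hmem' => ?_, hnd⟩
        have := List.mem_toFinset.2 hmem'
        rw [hset, hsd] at this
        simp at this
      · rw [List.map_cons, List.toFinset_cons, hset, hsd, Finset.insert_erase hq]
    rw [Ultrafilter.eventually_exists_mem_iff (finite_lists_of_length (Finset.finite_toSet _) _)]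
      at hev
    obtain ⟨C, ⟨hlen, hmem⟩, hC⟩ := hev
    obtain ⟨ε, hnd, hset, q, p, C', rfl, -⟩ := hC.exists
    refine ⟨(q, p) :: C', ⟨hlen, fun x hx => Finset.mem_coe.1 (hmem x hx)⟩, hnd, hset, ?_⟩
    change ∀ᶠ ε in (infinitesimal : Filter ℝ≥0), _
    filter_upwards [hC] with ε hε
    obtain ⟨-, -, q', p', C'', heq, hgen⟩ := hε
    obtain ⟨⟨rfl, rfl⟩, rfl⟩ : (q = q' ∧ p = p') ∧ C' = C'' := by simpa using heq
    exact hgen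

lemma WNNConsistent.correctOutside {w : X → ℝ} (hw : WNNConsistent l S T w)
    (hk : ∀ q ∈ T, k q = l q) (hpos : ∀ q ∈ T, 0 < w q) :
    CorrectOutside k l S T fun q => (w q).toNNReal := by
  intro p hp hpT
  obtain ⟨q, hq, hql, hlt⟩ := hw p hp
  have hdist : ∀ x ∈ T, 0 < dist p x := fun x hx => dist_pos.2 fun h => hpT (h ▸ hx)
  have hle : (w q).toNNReal / nndist p q ≤
      attraction k T (fun q => (w q).toNNReal) p (l p) :=
    Finset.le_sup (f := fun q => (w q).toNNReal / nndist p q)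
      (Finset.mem_filter.2 ⟨hq, (hk q hq).trans hql⟩)
  refine lt_of_lt_of_le ?_ hle
  rw [attraction, Finset.sup_lt_iff]
  · intro x hx
    obtain ⟨hxT, hxk⟩ := Finset.mem_filter.1 hx
    have h := hlt x hxT (by rw [← hk x hxT, hxk]; simp)
    rw [← NNReal.coe_lt_coe]
    push_cast
    rw [Real.coe_toNNReal _ (hpos x hxT).le, Real.coe_toNNReal _ (hpos q hq).le,
      div_lt_div_iff₀ (hdist x hxT) (hdist q hq)]
    rw [div_lt_div_iff₀ (hpos q hq) (hpos x hxT)] at h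
    linarith
  · have : 0 < nndist p q := hdist q hq
    exact div_pos (Real.toNNReal_pos.2 (hpos q hq)) this

end Weights

/-- Representation lemma: there is a reconstruction function `R`, mapping two finite
sequences of labeled points of `X` to a classifier, such that for every finite labeled
set `S`, every subset `S̃ ⊆ S` (of cardinality `m ≥ 1`) and every positive weight
function `w` on `S̃` making `(S̃, w)` WNN-consistent with `S`, there are an ordering
`e` of `S̃` and a sequence `W` of `m` labeled points of `S` such that the classifier
`R (labeled e) W` agrees with the labels on all of `S`. -/
theorem stmt3 (X : Type*) [MetricSpace X] :
    ∃ R : List (X × Bool) → List (X × Bool) → X → Bool,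
      ∀ (S : Finset X) (l : X → Bool) (St : Finset X),
        St ⊆ S → St.Nonempty →
        ∀ w : X → ℝ, (∀ q ∈ St, 0 < w q) →
          WNNConsistent l S St w →
          ∃ (e : List X) (W : List (X × Bool)),
            e.Nodup ∧ e.toFinset = St ∧ W.length = St.card ∧
            (∀ pr ∈ W, pr.1 ∈ S ∧ pr.2 = l pr.1) ∧
            ∀ x ∈ S, R (e.map fun z => (z, l z)) W x = l x := by
  refine ⟨fun E W x => if x ∈ (E.map Prod.fst).toFinset then decide ((x, true) ∈ E) else
    decide (∀ᶠ v in genericWeight (fun z => decide ((z, true) ∈ E)) ((E.map Prod.fst).zip W) ∅ 0,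
      attraction (fun z => decide ((z, true) ∈ E)) (E.map Prod.fst).toFinset v x false <
        attraction (fun z => decide ((z, true) ∈ E)) (E.map Prod.fst).toFinset v x true), ?_⟩
  intro S l T hT _ w hpos hw
  set k : X → Bool := fun z => decide (z ∈ T ∧ l z = true) with hk
  have hkl : ∀ q ∈ T, k q = l q := fun q hq => by simp [hk, hq]
  obtain ⟨C, ⟨hlen, hmem⟩, hnd, hset, hgen⟩ := CorrectOutside.exists_code hT T.card ∅
    (fun q => (w q).toNNReal) 0 (Finset.empty_subset T) (by simp)
    (fun q hq => Real.toNNReal_pos.2 (hpos q hq)) (hw.correctOutside hkl hpos) (by simp)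
  rw [Finset.sdiff_empty] at hset
  refine ⟨C.map Prod.fst, C.map fun x => (x.2, l x.2), hnd, hset, by simpa using hlen, ?_, ?_⟩
  · intro pr hpr
    obtain ⟨x, hx, rfl⟩ := List.mem_map.1 hpr
    exact ⟨(Finset.mem_product.1 (hmem x hx)).2, rfl⟩
  · intro x hx
    have hfst : ((C.map Prod.fst).map fun z => (z, l z)).map Prod.fst = C.map Prod.fst := by
      simp [Function.comp_def]
    have hkE : (fun z => decide ((z, true) ∈ (C.map Prod.fst).map fun z => (z, l z))) = k := by
      funext z
      rw [hk, decide_eq_decide, ← hset, List.mem_toFinset, List.mem_map]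
      constructor
      · rintro ⟨y, hy, hyz⟩
        obtain ⟨rfl, hl⟩ := Prod.mk.inj hyz
        exact ⟨hy, hl⟩
      · rintro ⟨hz, hl⟩
        exact ⟨z, hz, by rw [hl]⟩
    have hkx := congrFun hkE x
    simp only [hkE, hkx, hfst, hset, List.zip_map']
    split_ifs with hxT
    · exact hkl x hxT
    · have hx' := hgen.mono fun v hv => hv x hx hxT
      cases hl : l x with
      | true => simpa [hl] using hx'
      | false =>
        rw [decide_eq_false_iff_not]
        intro h
        obtain ⟨v, h1, h2⟩ := (h.and hx').exists
        rw [hl] at h2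
        exact lt_asymm h1 h2
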